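/- The signed-formula calculus SF₄ is sound and complete with respect to the matrix ⟨M4m, D⟩: a finite set Ω of signed formulas is provable in SF₄ if and only if Ω is valid (every valuation satisfies some signed formula in Ω). -/

import Mathlib

/-- Formulas built from propositional variables by the connectives `∧`, `∨`, `¬`, `□`
(no `⊥`). -/
inductive Formula : Type where
  | var : ℕ → Formula
  | and : Formula → Formula → Formula
  | or : Formula → Formula → Formula
  | neg : Formula → Formula
  | box : Formula → Formula
deriving DecidableEq
/-- The four-element diamond lattice `M4 = {0, n, b, 1}`, realized as `Bool × Bool`
with `0 = (false, false)`, `n = (true, false)`, `b = (false, true)`, `1 = (true, true)`. -/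
def M4 : Type := Bool × Bool

instance : DecidableEq M4 := inferInstanceAs (DecidableEq (Bool × Bool))
instance : Fintype M4 := inferInstanceAs (Fintype (Bool × Bool))
instance : DistribLattice M4 := inferInstanceAs (DistribLattice (Bool × Bool))
instance : BoundedOrder M4 := inferInstanceAs (BoundedOrder (Bool × Bool))

/-- De Morgan negation on `M4`: `¬0 = 1`, `¬1 = 0`, `¬n = n`, `¬b = b`. -/
def m4neg (a : M4) : M4 := (!a.2, !a.1)

/-- The modal operator on `M4`: `□1 = 1` and `□0 = □n = □b = 0`. -/
def m4box (a : M4) : M4 := (a.1 && a.2, a.1 && a.2)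

/-- The designated set `D = {b, 1}` of the matrix `⟨M4m, D⟩`. -/
def m4D (a : M4) : Prop := a.2 = true
/-- A valuation: a function from formulas to `M4` commuting with `∧, ∨, ¬, □`
(interpreted by the operations of the algebra `𝔐₄ₘ`). -/
structure Val4 where
  toFun : Formula → M4
  map_and : ∀ φ ψ : Formula, toFun (φ.and ψ) = toFun φ ⊓ toFun ψ
  map_or : ∀ φ ψ : Formula, toFun (φ.or ψ) = toFun φ ⊔ toFun ψ
  map_neg : ∀ φ : Formula, toFun φ.neg = m4neg (toFun φ)
  map_box : ∀ φ : Formula, toFun φ.box = m4box (toFun φ)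

/-- A signed formula is a pair `i:α` with `i ∈ M4`; a valuation `v` satisfies `i:α`
iff `v α = i`.  The calculus `SF₄` derives finite sets of signed formulas. -/
inductive SF4 : Finset (M4 × Formula) → Prop where
  | ax (α : Formula) :
      SF4 {((false, false), α), ((true, false), α), ((false, true), α), ((true, true), α)}
  | weak {Ω Ω' : Finset (M4 × Formula)} : Ω ⊆ Ω' → SF4 Ω → SF4 Ω'
  | orR {Ω : Finset (M4 × Formula)} (i j : M4) (α β : Formula) :
      SF4 (insert (i, α) Ω) → SF4 (insert (j, β) Ω) → SF4 (insert (i ⊔ j, α.or β) Ω)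
  | andR {Ω : Finset (M4 × Formula)} (i j : M4) (α β : Formula) :
      SF4 (insert (i, α) Ω) → SF4 (insert (j, β) Ω) → SF4 (insert (i ⊓ j, α.and β) Ω)
  | negR {Ω : Finset (M4 × Formula)} (i : M4) (α : Formula) :
      SF4 (insert (i, α) Ω) → SF4 (insert (m4neg i, α.neg) Ω)
  | boxR {Ω : Finset (M4 × Formula)} (i : M4) (α : Formula) :
      SF4 (insert (i, α) Ω) → SF4 (insert (m4box i, α.box) Ω)

/-- The axiom on `α` contains exactly the signed formulas `i:α`. -/
theorem mem_all_signs_iff {a b : Bool} {α β : Formula} :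
    ((a, b), β) ∈ ({((false, false), α), ((true, false), α), ((false, true), α),
      ((true, true), α)} : Finset ((Bool × Bool) × Formula)) ↔ β = α := by
  cases a <;> cases b <;> simp

/-- Soundness: every valuation satisfies every provable finite set of signed formulas. -/
theorem SF4.sound {Ω : Finset (M4 × Formula)} (h : SF4 Ω) (v : Val4) :
    ∃ p ∈ Ω, v.toFun p.2 = p.1 := by
  induction h with
  | ax α =>
    obtain ⟨a, b, hv⟩ : ∃ a b : Bool, v.toFun α = (a, b) := ⟨_, _, rfl⟩
    exact ⟨((a, b), α), mem_all_signs_iff.mpr rfl, hv⟩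
  | weak hsub _ ih =>
    obtain ⟨p, hp, hv⟩ := ih
    exact ⟨p, hsub hp, hv⟩
  | orR i j α β _ _ ih₁ ih₂ =>
    simp only [Finset.exists_mem_insert] at ih₁ ih₂ ⊢
    rw [v.map_or]
    grind
  | andR i j α β _ _ ih₁ ih₂ =>
    simp only [Finset.exists_mem_insert] at ih₁ ih₂ ⊢
    rw [v.map_and]
    grind
  | negR i α _ ih =>
    simp only [Finset.exists_mem_insert] at ih ⊢
    exact ih.imp_left fun h => by rw [v.map_neg, h]
  | boxR i α _ ih =>
    simp only [Finset.exists_mem_insert] at ih ⊢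
    exact ih.imp_left fun h => by rw [v.map_box, h]

/-- The value of a formula under an assignment of the propositional variables. -/
def Formula.eval (g : ℕ → M4) : Formula → M4
  | .var p => g p
  | .and α β => α.eval g ⊓ β.eval g
  | .or α β => α.eval g ⊔ β.eval g
  | .neg α => m4neg (α.eval g)
  | .box α => m4box (α.eval g)

/-- The valuation extending an assignment of the propositional variables. -/
def Val4.ofAssignment (g : ℕ → M4) : Val4 where
  toFun := Formula.eval g
  map_and _ _ := rfl
  map_or _ _ := rfl
  map_neg _ := rfl
  map_box _ := rfl

/-- Provability of `Δ, s` for a possibly infinite set `Δ` of side formulas. -/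
def SF4.DerivableOver (Δ : Set (M4 × Formula)) (s : M4 × Formula) : Prop :=
  ∃ Γ : Finset (M4 × Formula), ↑Γ ⊆ Δ ∧ SF4 (insert s Γ)

/-- Two derivations over `Δ` can be given the same finite set of side formulas. -/
theorem SF4.DerivableOver.exists_common {Δ : Set (M4 × Formula)} {s t : M4 × Formula}
    (hs : DerivableOver Δ s) (ht : DerivableOver Δ t) :
    ∃ Γ : Finset (M4 × Formula), ↑Γ ⊆ Δ ∧ SF4 (insert s Γ) ∧ SF4 (insert t Γ) := by
  obtain ⟨Γ₁, h₁, d₁⟩ := hs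
  obtain ⟨Γ₂, h₂, d₂⟩ := ht
  refine ⟨Γ₁ ∪ Γ₂, by simp [h₁, h₂], ?_, ?_⟩
  · exact d₁.weak (Finset.insert_subset_insert _ Finset.subset_union_left)
  · exact d₂.weak (Finset.insert_subset_insert _ Finset.subset_union_right)

theorem SF4.derivableOver_eval {Δ : Set (M4 × Formula)} {g : ℕ → M4}
    (h : ∀ p, DerivableOver Δ (g p, .var p)) (α : Formula) :
    DerivableOver Δ (α.eval g, α) := by
  induction α with
  | var p => exact h p
  | and α β ihα ihβ =>
    obtain ⟨Γ, hΓ, dα, dβ⟩ := ihα.exists_common ihβ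
    exact ⟨Γ, hΓ, .andR _ _ _ _ dα dβ⟩
  | or α β ihα ihβ =>
    obtain ⟨Γ, hΓ, dα, dβ⟩ := ihα.exists_common ihβ
    exact ⟨Γ, hΓ, .orR _ _ _ _ dα dβ⟩
  | neg α ih =>
    obtain ⟨Γ, hΓ, d⟩ := ih
    exact ⟨Γ, hΓ, .negR _ _ d⟩
  | box α ih =>
    obtain ⟨Γ, hΓ, d⟩ := ih
    exact ⟨Γ, hΓ, .boxR _ _ d⟩

/-- A set of signed formulas is unprovable if no finite subset of it is provable. -/
def SF4.Unprovable (Δ : Set (M4 × Formula)) : Prop :=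
  ∀ Γ : Finset (M4 × Formula), ↑Γ ⊆ Δ → ¬ SF4 Γ

theorem SF4.exists_maximal_unprovable {Ω : Finset (M4 × Formula)} (h : ¬ SF4 Ω) :
    ∃ Δ : Set (M4 × Formula), ↑Ω ⊆ Δ ∧ Maximal Unprovable Δ := by
  refine zorn_subset_nonempty {Δ | Unprovable Δ} (fun c hc hchain hne => ?_) ↑Ω ?_
  · refine ⟨⋃₀ c, fun Γ hΓ d => ?_, fun _ => Set.subset_sUnion_of_mem⟩
    obtain ⟨Δ, hΔ, hsub⟩ := hchain.directedOn.exists_mem_subset_of_finset_subset_biUnion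
      (f := id) hne (by simpa [Set.sUnion_eq_biUnion] using hΓ)
    exact hc hΔ Γ hsub d
  · exact fun Γ hΓ d => h (d.weak (by exact_mod_cast hΓ))

theorem SF4.derivableOver_of_notMem {Δ : Set (M4 × Formula)} (hΔ : Maximal Unprovable Δ)
    {s : M4 × Formula} (hs : s ∉ Δ) : DerivableOver Δ s := by
  by_contra hd
  refine hs (hΔ.le_of_ge (y := insert s Δ) (fun Γ hΓ d => hd ?_) (Set.subset_insert s Δ)
    (Set.mem_insert s Δ))
  refine ⟨Γ.erase s, ?_, d.weak (Finset.insert_erase_subset s Γ)⟩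
  simpa using hΓ

theorem SF4.exists_notMem {Δ : Set (M4 × Formula)} (hΔ : Unprovable Δ) (α : Formula) :
    ∃ i : M4, (i, α) ∉ Δ := by
  by_contra! h
  refine hΔ _ ?_ (.ax α)
  rintro ⟨⟨a, b⟩, β⟩ hβ
  obtain rfl : β = α := mem_all_signs_iff.mp hβ
  exact h (a, b)

/-- Completeness: every valid finite set of signed formulas is provable. -/
theorem SF4.complete {Ω : Finset (M4 × Formula)}
    (h : ∀ v : Val4, ∃ p ∈ Ω, v.toFun p.2 = p.1) : SF4 Ω := by
  by_contra hΩ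
  obtain ⟨Δ, hΩΔ, hΔ⟩ := exists_maximal_unprovable hΩ
  choose g hg using fun p => exists_notMem hΔ.prop (.var p)
  obtain ⟨⟨i, α⟩, hmem, rfl : α.eval g = i⟩ := h (.ofAssignment g)
  obtain ⟨Γ, hΓ, d⟩ := derivableOver_eval (fun p => derivableOver_of_notMem hΔ (hg p)) α
  exact hΔ.prop _ (by simpa [Set.insert_subset_iff, hΓ] using hΩΔ hmem) d

/-- Soundness and completeness of `SF₄` w.r.t. the matrix `⟨M4m, D⟩`: a finite set of
signed formulas is provable iff every valuation satisfies some signed formula in it. -/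
theorem sf4_sound_complete (Ω : Finset (M4 × Formula)) :
    SF4 Ω ↔ ∀ v : Val4, ∃ p ∈ Ω, v.toFun p.2 = p.1 :=
  ⟨SF4.sound, SF4.complete⟩
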